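/- Let n ≥ 2 and g ∈ SL_{2n}(ℝ). The symplectic form ⟨·,·⟩^g is rational if and only if the orbit of the identity coset under Sp(2n,ℝ)^g, i.e., the set {h·SL_{2n}(ℤ) : h ∈ Sp(2n,ℝ)^g} ⊆ SL_{2n}(ℝ)/SL_{2n}(ℤ), is a closed subset of SL_{2n}(ℝ)/SL_{2n}(ℤ) in the quotient topology. -/

import Mathlib

open Matrix

noncomputable section

/-- The standard symplectic matrix `J_n` with block form `(0 Iₙ; -Iₙ 0)`. -/
def Jmat (n : ℕ) : Matrix (Fin (2*n)) (Fin (2*n)) ℝ :=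
  fun i j => if (i : ℕ) + n = (j : ℕ) then 1 else if (j : ℕ) + n = (i : ℕ) then -1 else 0

abbrev SL2n (n : ℕ) := Matrix.SpecialLinearGroup (Fin (2*n)) ℝ

noncomputable instance (m : ℕ) : TopologicalSpace (Matrix.SpecialLinearGroup (Fin m) ℝ) :=
  instTopologicalSpaceSubtype

/-- `SL_{2n}(ℤ)`, viewed as a subgroup of `SL_{2n}(ℝ)`. -/
def SLZ (n : ℕ) : Subgroup (SL2n n) :=
  (Matrix.SpecialLinearGroup.map (n := Fin (2*n)) (Int.castRingHom ℝ)).range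

/-- The form `⟨·,·⟩^g` is rational: some nonzero scalar multiple of `gᵀ Jₙ g` has
integer entries. -/
def IsRationalForm (n : ℕ) (g : SL2n n) : Prop :=
  ∃ c : ℝ, c ≠ 0 ∧ ∀ i j, ∃ m : ℤ,
    c * (((g : Matrix (Fin (2*n)) (Fin (2*n)) ℝ)ᵀ * Jmat n *
          (g : Matrix (Fin (2*n)) (Fin (2*n)) ℝ)) i j) = (m : ℝ)

/-- The conjugated symplectic group `Sp(2n,ℝ)^g = g⁻¹ Sp(2n,ℝ) g`, where
`Sp(2n,ℝ) = {s ∈ SL_{2n}(ℝ) : sᵀ Jₙ s = Jₙ}`. -/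
def SpConj (n : ℕ) (g : SL2n n) : Set (SL2n n) :=
  {h | ∃ s : SL2n n,
    (s : Matrix (Fin (2*n)) (Fin (2*n)) ℝ)ᵀ * Jmat n *
      (s : Matrix (Fin (2*n)) (Fin (2*n)) ℝ) = Jmat n ∧ h = g⁻¹ * s * g}


lemma discrete_of_closed_countable {m : ℕ} (L : AddSubgroup (Fin m → ℝ))
    (hc : (closure (L : Set (Fin m → ℝ))).Countable) : DiscreteTopology L := by
  let K := L.topologicalClosure
  have hK : IsClosed (K : Set (Fin m → ℝ)) := L.isClosed_topologicalClosure
  have hcK : Countable K := hc.to_subtype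
  have : CompleteSpace K := hK.completeSpace_coe
  have hdK : DiscreteTopology K := by
    obtain ⟨i, hi⟩ := nonempty_interior_of_iUnion_of_closed (X := K) (ι := K) (f := fun i => {i})
      (fun i => isClosed_singleton) (by ext; simp)
    have h1 : IsOpen ({i} : Set K) := by
      have : interior {i} = ({i} : Set K) := by
        apply Set.Subset.antisymm interior_subset
        obtain ⟨y, hy⟩ := hi
        have := interior_subset hy
        simp at this
        subst this
        simpa using hy
      rw [← this]; exact isOpen_interior
    exact discreteTopology_of_isOpen_singleton_zero (by
      have := (Homeomorph.addLeft (-i)).isOpenMap _ h1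
      simpa using this)
  exact DiscreteTopology.of_subset (s := (K : Set (Fin m → ℝ))) hdK L.le_topologicalClosure

lemma form_shear {m : ℕ} (ω : Matrix (Fin m) (Fin m) ℝ) (hω : ωᵀ = -ω) (p l : Fin m → ℝ) :
    (1 + vecMulVec p l)ᵀ * ω * (1 + vecMulVec p l) =
      ω + vecMulVec (ω *ᵥ p) l - vecMulVec l (ω *ᵥ p) := by
  have h0 : p ᵥ* ω = - (ω *ᵥ p) := by
    rw [← mulVec_transpose, hω, neg_mulVec]
  have h1 : (ω *ᵥ p) ⬝ᵥ p = 0 := by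
    have h2 : (ω *ᵥ p) ⬝ᵥ p = - ((ω *ᵥ p) ⬝ᵥ p) := by
      nth_rw 1 [dotProduct_comm, dotProduct_mulVec, h0, neg_dotProduct]
    linarith
  simp only [transpose_add, transpose_one, transpose_vecMulVec, add_mul, mul_add, one_mul, mul_one,
    vecMulVec_mul, mul_vecMulVec, h0, vecMulVec_mulVec, neg_dotProduct, h1]
  ext i j
  simp [vecMulVec_apply]
  ring

lemma det_shear {m : ℕ} {R : Type*} [CommRing R] (p l : Fin m → R) :
    (1 + vecMulVec p l).det = 1 + l ⬝ᵥ p := by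
  rw [vecMulVec_eq Unit, det_one_add_replicateCol_mul_replicateRow]

def orbSet {m : ℕ} (ω : Matrix (Fin m) (Fin m) ℝ) : Set (Matrix (Fin m) (Fin m) ℝ) :=
  {X | X.det = 1 ∧ ∃ γ : Matrix (Fin m) (Fin m) ℤ, γ.det = 1 ∧
    Xᵀ * ω * X = (γ.map (Int.cast : ℤ → ℝ))ᵀ * ω * γ.map (Int.cast : ℤ → ℝ)}

lemma key {m : ℕ} (ω : Matrix (Fin m) (Fin m) ℝ) (hω : ωᵀ = -ω) (hu : IsUnit ω.det)
    (hP : IsClosed (orbSet ω)) (ℓ : Fin m → ℤ) (i0 : Fin m) (h0 : ℓ i0 ≠ 0) :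
    ∃ (z : Fin m → ℤ) (t : ℝ), t ≠ 0 ∧
      ω *ᵥ (fun i => (z i : ℝ)) = t • (fun i => (ℓ i : ℝ)) := by
  set l : Fin m → ℝ := fun i => (ℓ i : ℝ) with hl
  have hll : l ⬝ᵥ l ≠ 0 := by
    intro h
    have := congrFun (dotProduct_self_eq_zero.1 h) i0
    simp [hl, h0] at this
  have hl0 : l i0 ≠ 0 := by simpa [hl] using h0
  have hwl : l ⬝ᵥ (ω⁻¹ *ᵥ l) = 0 := by
    have h1 : (ω⁻¹)ᵀ = - ω⁻¹ := by
      rw [transpose_nonsing_inv, hω]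
      apply Matrix.inv_eq_left_inv
      rw [neg_mul_neg, nonsing_inv_mul _ hu]
    have h2 : l ⬝ᵥ (ω⁻¹ *ᵥ l) = - (l ⬝ᵥ (ω⁻¹ *ᵥ l)) := by
      nth_rw 1 [dotProduct_mulVec, ← mulVec_transpose, h1, neg_mulVec, neg_dotProduct,
        dotProduct_comm]
    linarith
  -- the projection
  let C : (Fin m → ℝ) →ₗ[ℝ] (Fin m → ℝ) :=
    { toFun := fun p => ω *ᵥ p - ((l ⬝ᵥ (ω *ᵥ p)) / (l ⬝ᵥ l)) • l
      map_add' := by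
        intro x y; ext i; simp [mulVec_add, dotProduct_add]; ring
      map_smul' := by
        intro x y; ext i; simp [mulVec_smul, dotProduct_smul]; ring }
  have hC : ∀ p, C p = ω *ᵥ p - ((l ⬝ᵥ (ω *ᵥ p)) / (l ⬝ᵥ l)) • l := fun p => rfl
  have hCl : ∀ p, l ⬝ᵥ C p = 0 := by
    intro p; rw [hC, dotProduct_sub, dotProduct_smul, smul_eq_mul]; field_simp; ring
  let bZ : {j // j ≠ i0} → (Fin m → ℤ) := fun j => Pi.single j.1 (ℓ i0) - Pi.single i0 (ℓ j.1)
  let b : {j // j ≠ i0} → (Fin m → ℝ) := fun j => Pi.single j.1 (l i0) - Pi.single i0 (l j.1)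
  have hb : ∀ (c : {j // j ≠ i0} → ℝ) (j : {j // j ≠ i0}), (∑ i, c i • b i) j.1 = c j * l i0 := by
    intro c j
    rw [Finset.sum_apply, Finset.sum_eq_single j]
    · simp [b, j.2]
    · intro k _ hk
      have : j.1 ≠ k.1 := fun h => hk (Subtype.ext h.symm)
      simp [b, this, j.2]
    · simp
  have hbl : ∀ j, l ⬝ᵥ b j = 0 := by
    intro j; simp [b, dotProduct_sub]; ring
  -- real dependence
  have hdep : ¬ LinearIndependent ℝ (fun j => C (b j)) := by
    intro hli
    set w := ω⁻¹ *ᵥ l with hw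
    have hωw : ω *ᵥ w = l := by rw [hw, mulVec_mulVec, mul_nonsing_inv _ hu, one_mulVec]
    have hsum : ∑ j : {j // j ≠ i0}, (w j.1 / l i0) • b j = w := by
      have h1 : ∀ j, j ≠ i0 → (∑ j : {j // j ≠ i0}, (w j.1 / l i0) • b j) j = w j := by
        intro j hj
        have := hb (fun j => w j.1 / l i0) ⟨j, hj⟩
        rw [this]; field_simp
      have h2 : l ⬝ᵥ ((∑ j : {j // j ≠ i0}, (w j.1 / l i0) • b j) - w) = 0 := by
        rw [dotProduct_sub, hwl, dotProduct_sum]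
        simp [dotProduct_smul, hbl]
      rw [dotProduct, Finset.sum_eq_single i0] at h2
      · funext j
        by_cases hj : j = i0
        · subst hj
          have := (mul_eq_zero.1 h2).resolve_left hl0
          simpa [sub_eq_zero] using this
        · exact h1 j hj
      · intro j _ hj
        simp only [Pi.sub_apply]
        rw [h1 j hj]; simp
      · simp
    have hz : ∑ j : {j // j ≠ i0}, (w j.1 / l i0) • C (b j) = 0 := by
      have hCw : C w = 0 := by rw [hC, hωw, div_self hll, one_smul, sub_self]
      rw [← hsum, map_sum] at hCw
      rw [← hCw]
      exact Finset.sum_congr rfl fun j _ => (map_smul C _ _).symm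
    have := Fintype.linearIndependent_iff.1 hli _ hz
    have hw0 : w = 0 := by rw [← hsum]; simp [this]
    rw [hw0] at hωw
    simp at hωw
    rw [← hωw] at hl0
    simp at hl0
  let S : Set (Fin m → ℝ) := Set.range (fun j => C (b j))
  let L := Submodule.span ℤ S
  -- elements of L
  have hL : ∀ q ∈ L, ∃ z : Fin m → ℤ, l ⬝ᵥ (fun i => (z i : ℝ)) = 0 ∧
      C (fun i => (z i : ℝ)) = q := by
    intro q hq
    induction hq using Submodule.span_induction with
    | mem x hx =>
      obtain ⟨j, rfl⟩ := hx
      have : (fun i => (bZ j i : ℝ)) = b j := by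
        ext i; simp only [bZ, b, hl, Pi.sub_apply, Pi.single_apply]; push_cast; rfl
      exact ⟨bZ j, by rw [this]; exact hbl j, by rw [this]⟩
    | zero => exact ⟨0, by simp [dotProduct], by rw [← map_zero C]; congr 1; ext; simp⟩
    | add x y _ _ hx hy =>
      obtain ⟨z, h1, h2⟩ := hx
      obtain ⟨z', h1', h2'⟩ := hy
      have : (fun i => ((z + z') i : ℝ)) = (fun i => (z i : ℝ)) + (fun i => (z' i : ℝ)) := by
        ext; simp
      exact ⟨z + z', by rw [this, dotProduct_add, h1, h1', add_zero], by rw [this, map_add, h2, h2']⟩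
    | smul a x _ hx =>
      obtain ⟨z, h1, h2⟩ := hx
      have : (fun i => ((a • z) i : ℝ)) = (a : ℝ) • (fun i => (z i : ℝ)) := by
        ext; simp
      refine ⟨a • z, by rw [this, dotProduct_smul, h1, smul_zero], ?_⟩
      rw [this, map_smul, h2]; ext; simp
  have hcl1 : closure (L : Set (Fin m → ℝ)) ⊆
      {q | 1 + vecMulVec (ω⁻¹ *ᵥ q) l ∈ orbSet ω} := by
    apply closure_minimal
    · intro q hq
      obtain ⟨z, h1, h2⟩ := hL q hq
      set μ := ((l ⬝ᵥ (ω *ᵥ (fun i => (z i : ℝ)))) / (l ⬝ᵥ l))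
      have h3 : ω *ᵥ (fun i => (z i : ℝ)) = q + μ • l := by
        rw [← h2, hC]; simp [μ]
      have h4 : ω⁻¹ *ᵥ q = (fun i => (z i : ℝ)) - μ • (ω⁻¹ *ᵥ l) := by
        have : q = ω *ᵥ (fun i => (z i : ℝ)) - μ • l := by rw [h3]; simp
        rw [this, mulVec_sub, mulVec_mulVec, nonsing_inv_mul _ hu, one_mulVec, mulVec_smul]
      refine ⟨?_, 1 + vecMulVec z ℓ, ?_, ?_⟩
      · rw [det_shear, h4, dotProduct_sub, h1, dotProduct_smul, hwl]; simp
      · rw [det_shear]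
        have : ((ℓ ⬝ᵥ z : ℤ) : ℝ) = 0 := by rw [← h1]; simp [dotProduct, hl]
        have : ℓ ⬝ᵥ z = 0 := by exact_mod_cast this
        rw [this, add_zero]
      · have : (1 + vecMulVec z ℓ).map (Int.cast : ℤ → ℝ) =
            1 + vecMulVec (fun i => (z i : ℝ)) l := by
          ext i j
          simp [vecMulVec_apply, hl, Matrix.one_apply]
        rw [this, form_shear ω hω, form_shear ω hω, mulVec_mulVec, mul_nonsing_inv _ hu,
          one_mulVec, h3]
        ext i j
        simp [vecMulVec_apply]; ring
    · apply hP.preimage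
      apply Continuous.add continuous_const
      apply Continuous.matrix_vecMulVec _ continuous_const
      exact Continuous.matrix_mulVec continuous_const continuous_id
  have hcl2 : closure (L : Set (Fin m → ℝ)) ⊆ {q | l ⬝ᵥ q = 0} := by
    apply closure_minimal
    · intro q hq
      obtain ⟨z, h1, h2⟩ := hL q hq
      rw [← h2]; exact hCl _
    · exact isClosed_eq (Continuous.dotProduct continuous_const continuous_id) continuous_const
  have hcount : (closure (L : Set (Fin m → ℝ))).Countable := by
    have hr : (Set.range (fun γ : Matrix (Fin m) (Fin m) ℤ => (l ⬝ᵥ l)⁻¹ •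
      (((γ.map (Int.cast : ℤ → ℝ))ᵀ * ω * γ.map (Int.cast : ℤ → ℝ) - ω) *ᵥ l))).Countable := by
      have : Countable (Matrix (Fin m) (Fin m) ℤ) :=
        inferInstanceAs (Countable (Fin m → Fin m → ℤ))
      exact Set.countable_range _
    refine hr.mono ?_
    intro q hq
    obtain ⟨h1, γ, h2, h3⟩ := hcl1 hq
    have h4 : l ⬝ᵥ q = 0 := hcl2 hq
    refine ⟨γ, ?_⟩
    simp only
    rw [← h3, form_shear ω hω, mulVec_mulVec, mul_nonsing_inv _ hu, one_mulVec, add_sub_assoc,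
      add_sub_cancel_left, sub_mulVec, vecMulVec_mulVec, vecMulVec_mulVec, dotProduct_comm q, h4]
    ext i
    simp
    field_simp
  have hdisc : DiscreteTopology L := discrete_of_closed_countable L.toAddSubgroup hcount
  have hrank := Real.finrank_eq_int_finrank_of_discrete hdisc
  have hnZ : ¬ LinearIndependent ℤ (fun j => C (b j)) := by
    intro h
    apply hdep
    rw [linearIndependent_iff_card_eq_finrank_span] at h ⊢
    rw [h]; exact hrank.symm
  rw [Fintype.not_linearIndependent_iff] at hnZ
  obtain ⟨c, hc, j, hj⟩ := hnZ
  have hcast : (fun i => ((∑ j, c j • bZ j) i : ℝ)) = ∑ j, (c j : ℝ) • b j := by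
    ext i
    simp only [Finset.sum_apply, bZ, b, hl, Pi.sub_apply, Pi.single_apply, Pi.smul_apply,
      smul_eq_mul]
    push_cast; rfl
  have hCz : C (∑ j, (c j : ℝ) • b j) = 0 := by
    rw [map_sum, ← hc]
    refine Finset.sum_congr rfl fun j _ => ?_
    rw [map_smul]; ext; simp
  refine ⟨∑ j, c j • bZ j, (l ⬝ᵥ (ω *ᵥ (∑ j, (c j : ℝ) • b j))) / (l ⬝ᵥ l), ?_, ?_⟩
  swap
  · rw [hcast]; rw [hC] at hCz; exact sub_eq_zero.1 hCz
  · intro ht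
    rw [hC, ht, zero_smul, sub_zero] at hCz
    have h5 : (∑ j, (c j : ℝ) • b j) = 0 := by
      have := congrArg (fun v => ω⁻¹ *ᵥ v) hCz
      simpa [mulVec_mulVec, nonsing_inv_mul _ hu] using this
    have := hb (fun j => (c j : ℝ)) j
    rw [h5] at this
    simp [hl0, hj] at this

lemma rational_of_key {m : ℕ} (ω : Matrix (Fin m) (Fin m) ℝ) (hu : IsUnit ω.det)
    (hk : ∀ (ℓ : Fin m → ℤ) (i0 : Fin m), ℓ i0 ≠ 0 → ∃ (z : Fin m → ℤ) (t : ℝ), t ≠ 0 ∧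
      ω *ᵥ (fun i => (z i : ℝ)) = t • (fun i => (ℓ i : ℝ))) :
    ∃ c : ℝ, c ≠ 0 ∧ ∀ i j, ∃ k : ℤ, c * ω i j = k := by
  rcases Nat.eq_zero_or_pos m with rfl | hm
  · exact ⟨1, one_ne_zero, fun i => i.elim0⟩
  choose z t ht hz using fun i : Fin m => hk (Pi.single i 1) i (by simp)
  obtain ⟨y, s, hs, hy⟩ := hk (fun _ => 1) ⟨0, hm⟩ (by simp)
  let Z : Matrix (Fin m) (Fin m) ℤ := Matrix.of fun i j => z j i
  let ZR : Matrix (Fin m) (Fin m) ℝ := Z.map (Int.cast : ℤ → ℝ)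
  have hZ : ω * ZR = diagonal t := by
    ext i j
    have := congrFun (hz j) i
    simp only [mulVec, dotProduct, Pi.smul_apply, smul_eq_mul] at this
    simp only [Matrix.mul_apply, ZR, Z, Matrix.map_apply, Matrix.of_apply]
    rw [this, diagonal_apply]
    by_cases h : i = j
    · subst h; simp
    · simp [h]
  have hadj : (Z.adjugate).map (Int.cast : ℤ → ℝ) = ZR.adjugate := by
    have := (Int.castRingHom ℝ).map_adjugate Z
    simpa [ZR] using this
  have hdet : ZR.det ≠ 0 := by
    intro h
    have := congrArg det hZ
    rw [det_mul, h, mul_zero, det_diagonal] at this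
    exact Finset.prod_ne_zero_iff.2 (fun i _ => ht i) this.symm
  -- v = adj Z y, integer
  let v : Fin m → ℤ := Z.adjugate *ᵥ y
  have hωadj : ZR.det • ω = diagonal t * ZR.adjugate := by
    rw [← hZ, Matrix.mul_assoc, mul_adjugate]; simp
  have hv : ∀ i, ZR.det * s = t i * (v i : ℝ) := by
    intro i
    have h1 : (fun i => (v i : ℝ)) = ZR.adjugate *ᵥ (fun i => (y i : ℝ)) := by
      rw [← hadj]; ext i; simp [v, mulVec, dotProduct]
    have h2 : (ZR.det • ω) *ᵥ (fun i => (y i : ℝ)) = diagonal t *ᵥ (fun i => (v i : ℝ)) := by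
      rw [hωadj, ← mulVec_mulVec, h1]
    have := congrFun h2 i
    rw [smul_mulVec, hy, mulVec_diagonal] at this
    simpa using this
  have hv0 : ∀ i, (v i : ℝ) ≠ 0 := by
    intro i h
    have := hv i
    rw [h, mul_zero] at this
    exact mul_ne_zero hdet hs this
  refine ⟨(∏ i, (v i : ℝ)) / s, div_ne_zero (Finset.prod_ne_zero_iff.2 fun i _ => hv0 i) hs, ?_⟩
  intro i j
  refine ⟨(∏ k ∈ Finset.univ.erase i, v k) * Z.adjugate i j, ?_⟩
  have h1 : ZR.det * ω i j = t i * (Z.adjugate i j : ℝ) := by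
    have := congrFun (congrFun hωadj i) j
    rw [diagonal_mul, ← hadj] at this
    simpa using this
  rw [← Finset.mul_prod_erase Finset.univ (fun i => (v i : ℝ)) (Finset.mem_univ i)]
  push_cast
  have h2 := hv i
  have h3 : (v i : ℝ) * ω i j = s * (Z.adjugate i j : ℝ) := by
    have h4 : t i * ((v i : ℝ) * ω i j) = t i * (s * (Z.adjugate i j : ℝ)) := by
      linear_combination (-ω i j) * h2 + s * h1
    exact mul_left_cancel₀ (ht i) h4
  field_simp
  linear_combination (∏ k ∈ Finset.univ.erase i, (v k : ℝ)) * h3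

lemma Jmat_transpose (n : ℕ) (hn : 2 ≤ n) : (Jmat n)ᵀ = - Jmat n := by
  ext i j
  simp only [transpose_apply, Jmat, Matrix.neg_apply]
  split_ifs <;> first | omega | simp

lemma Jmat_sq (n : ℕ) (hn : 2 ≤ n) : Jmat n * Jmat n = -1 := by
  ext i j
  rw [Matrix.mul_apply]
  have hi := i.2
  have hj := j.2
  let k : Fin (2*n) := if h : (i : ℕ) < n then ⟨i + n, by omega⟩ else ⟨i - n, by omega⟩
  have hk : (k : ℕ) = if (i : ℕ) < n then (i : ℕ) + n else i - n := by
    simp only [k]; split_ifs <;> rfl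
  rw [Finset.sum_eq_single k]
  · simp only [Jmat, Matrix.neg_apply, Matrix.one_apply, Fin.ext_iff]
    by_cases h : (i : ℕ) < n
    · rw [if_pos h] at hk
      split_ifs <;> first | omega | norm_num
    · rw [if_neg h] at hk
      split_ifs <;> first | omega | norm_num
  · intro b _ hb
    have hb2 := b.2
    rw [Ne, Fin.ext_iff, hk] at hb
    have : Jmat n i b = 0 := by
      simp only [Jmat]
      split_ifs at * <;> first | omega | rfl
    rw [this, zero_mul]
  · simp

lemma preimage_iff (n : ℕ) (g : SL2n n) (x : SL2n n) :
    (QuotientGroup.mk x : SL2n n ⧸ SLZ n) ∈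
      ((QuotientGroup.mk : SL2n n → SL2n n ⧸ SLZ n) '' SpConj n g) ↔
    x.1 ∈ orbSet (g.1ᵀ * Jmat n * g.1) := by
  constructor
  · rintro ⟨h, ⟨s, hs, rfl⟩, hx⟩
    rw [QuotientGroup.eq] at hx
    obtain ⟨γ, hγ⟩ := hx
    have hx : x = g⁻¹ * s * g * Matrix.SpecialLinearGroup.map (Int.castRingHom ℝ) γ := by
      rw [hγ]; group
    refine ⟨x.2, γ.1, γ.2, ?_⟩
    have h1 : g.1 * x.1 = s.1 * g.1 * γ.1.map (Int.cast : ℤ → ℝ) := by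
      have : g * x = s * g * Matrix.SpecialLinearGroup.map (Int.castRingHom ℝ) γ := by
        rw [hx]; group
      exact congrArg Subtype.val this
    calc x.1ᵀ * (g.1ᵀ * Jmat n * g.1) * x.1 = (g.1 * x.1)ᵀ * Jmat n * (g.1 * x.1) := by
          rw [transpose_mul]; simp only [Matrix.mul_assoc]
      _ = (γ.1.map (Int.cast : ℤ → ℝ))ᵀ * (g.1ᵀ * (s.1ᵀ * Jmat n * s.1) * g.1) *
            γ.1.map (Int.cast : ℤ → ℝ) := by
          rw [h1]; simp only [transpose_mul, Matrix.mul_assoc]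
      _ = _ := by rw [hs]
  · rintro ⟨-, γ, hγ, h⟩
    let γ' : SL2n n := Matrix.SpecialLinearGroup.map (Int.castRingHom ℝ) ⟨γ, hγ⟩
    have hγ' : γ'.1 = γ.map (Int.cast : ℤ → ℝ) := rfl
    refine ⟨x * γ'⁻¹, ⟨g * x * γ'⁻¹ * g⁻¹, ?_, by group⟩, ?_⟩
    · rw [← hγ'] at h
      have e1 : γ'.1 * (γ'⁻¹ * g⁻¹).1 = (g⁻¹).1 := by
        have : γ' * (γ'⁻¹ * g⁻¹) = g⁻¹ := by group
        exact congrArg Subtype.val this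
      have e2 : g.1 * (g⁻¹).1 = 1 := by
        have : g * g⁻¹ = 1 := by group
        exact congrArg Subtype.val this
      have e3 : (g * x * γ'⁻¹ * g⁻¹).1 = g.1 * x.1 * (γ'⁻¹ * g⁻¹).1 := by
        have : (g * x * γ'⁻¹ * g⁻¹) = g * x * (γ'⁻¹ * g⁻¹) := by group
        exact congrArg Subtype.val this
      rw [e3]
      calc _ = ((γ'⁻¹ * g⁻¹).1)ᵀ * (x.1ᵀ * (g.1ᵀ * Jmat n * g.1) * x.1) * (γ'⁻¹ * g⁻¹).1 := by
            simp only [transpose_mul, Matrix.mul_assoc]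
        _ = (g.1 * (γ'.1 * (γ'⁻¹ * g⁻¹).1))ᵀ * Jmat n * (g.1 * (γ'.1 * (γ'⁻¹ * g⁻¹).1)) := by
            rw [h]; simp only [transpose_mul, Matrix.mul_assoc]
        _ = Jmat n := by rw [e1, e2]; simp
    · rw [QuotientGroup.eq]
      have : (x * γ'⁻¹)⁻¹ * x = γ' := by group
      rw [this]
      exact ⟨_, rfl⟩

lemma closed_iff (n : ℕ) (g : SL2n n) :
    IsClosed ((QuotientGroup.mk : SL2n n → SL2n n ⧸ SLZ n) '' SpConj n g) ↔
      IsClosed (orbSet (g.1ᵀ * Jmat n * g.1)) := by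
  have hq : Topology.IsQuotientMap (QuotientGroup.mk : SL2n n → SL2n n ⧸ SLZ n) :=
    isQuotientMap_quot_mk
  rw [← hq.isClosed_preimage]
  have hce : Topology.IsClosedEmbedding (Subtype.val : SL2n n → Matrix (Fin (2*n)) (Fin (2*n)) ℝ) :=
    IsClosed.isClosedEmbedding_subtypeVal
      (isClosed_eq (Continuous.matrix_det continuous_id) continuous_const)
  refine Iff.trans (hce.isClosed_iff_image_isClosed (s := _)) ?_
  have : (Subtype.val : SL2n n → Matrix (Fin (2*n)) (Fin (2*n)) ℝ) ''
      ((QuotientGroup.mk : SL2n n → SL2n n ⧸ SLZ n) ⁻¹'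
      ((QuotientGroup.mk : SL2n n → SL2n n ⧸ SLZ n) '' SpConj n g)) =
      orbSet (g.1ᵀ * Jmat n * g.1) := by
    ext X
    constructor
    · rintro ⟨x, hx, rfl⟩
      exact (preimage_iff n g x).1 hx
    · intro hX
      exact ⟨⟨X, hX.1⟩, (preimage_iff n g ⟨X, hX.1⟩).2 hX, rfl⟩
  exact Eq.to_iff (congrArg IsClosed this)

lemma closed_int {m : ℕ} (T : Set (Matrix (Fin m) (Fin m) ℝ))
    (hT : ∀ X ∈ T, ∀ i j, ∃ k : ℤ, X i j = k) : IsClosed T := by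
  have h1 : Topology.IsClosedEmbedding
      (fun (M : Fin m → Fin m → ℤ) (i j : Fin m) => ((M i j : ℤ) : ℝ)) := by
    have h := Int.isClosedEmbedding_coe_real
    exact Topology.IsClosedEmbedding.piMap fun _ => Topology.IsClosedEmbedding.piMap fun _ => h
  have h2 := h1.isClosedMap ((fun (M : Fin m → Fin m → ℤ) (i j : Fin m) => ((M i j : ℤ) : ℝ)) ⁻¹' T)
    (isClosed_discrete _)
  have h3 := Set.image_preimage_eq_of_subset (s := T)
    (f := fun (M : Fin m → Fin m → ℤ) (i j : Fin m) => ((M i j : ℤ) : ℝ)) ?_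
  · exact h3 ▸ h2
  · intro X hX
    choose M hM using hT X hX
    exact ⟨M, by ext i j; exact (hM i j).symm⟩

lemma closed_of_rational {m : ℕ} (ω : Matrix (Fin m) (Fin m) ℝ)
    (h : ∃ c : ℝ, c ≠ 0 ∧ ∀ i j, ∃ k : ℤ, c * ω i j = k) : IsClosed (orbSet ω) := by
  obtain ⟨c, hc, h⟩ := h
  choose M hM using h
  have hM' : c • ω = (Matrix.of M).map (Int.cast : ℤ → ℝ) := by ext i j; simp [hM]
  let T : Set (Matrix (Fin m) (Fin m) ℝ) := {Y | ∃ γ : Matrix (Fin m) (Fin m) ℤ, γ.det = 1 ∧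
    Y = (γ.map (Int.cast : ℤ → ℝ))ᵀ * (c • ω) * γ.map (Int.cast : ℤ → ℝ)}
  have hT : IsClosed T := by
    apply closed_int
    rintro X ⟨γ, -, rfl⟩ i j
    refine ⟨(γᵀ * Matrix.of M * γ) i j, ?_⟩
    rw [hM']
    simp [Matrix.mul_apply]
  have : orbSet ω = {X | X.det = 1} ∩ (fun X => Xᵀ * (c • ω) * X) ⁻¹' T := by
    ext X
    refine and_congr_right fun _ => exists_congr fun γ => and_congr_right fun _ => ?_
    simp only [Matrix.mul_smul, Matrix.smul_mul]
    exact (smul_right_injective _ hc).eq_iff.symm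
  rw [this]
  refine (isClosed_eq (Continuous.matrix_det continuous_id) continuous_const).inter (hT.preimage ?_)
  fun_prop

/-- The form `⟨·,·⟩^g` is rational if and only if the orbit
`Sp(2n,ℝ)^g · SL_{2n}(ℤ)/SL_{2n}(ℤ)` is closed in `SL_{2n}(ℝ)/SL_{2n}(ℤ)`. -/
theorem stmt18 (n : ℕ) (hn : 2 ≤ n) (g : SL2n n) :
    IsRationalForm n g ↔
      IsClosed ((QuotientGroup.mk : SL2n n → SL2n n ⧸ SLZ n) '' SpConj n g) := by
  rw [closed_iff]
  constructor
  · intro h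
    exact closed_of_rational _ h
  · intro h
    have hJ := Jmat_sq n hn
    have hu : IsUnit (g.1ᵀ * Jmat n * g.1).det := by
      have h2 : IsUnit (Jmat n).det := by
        rw [← Matrix.isUnit_iff_isUnit_det]
        have : Jmat n * (- Jmat n) = 1 := by rw [mul_neg, hJ, neg_neg]
        exact IsUnit.of_mul_eq_one _ this
      rw [det_mul, det_mul, det_transpose, g.2]
      simpa using h2
    exact rational_of_key _ hu fun ℓ i0 h0 => key _ (by
      simp only [transpose_mul, transpose_transpose, Jmat_transpose n hn, Matrix.mul_assoc,
        Matrix.neg_mul, Matrix.mul_neg]) hu h ℓ i0 h0
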